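/- arXiv:2106.09404 — 2 statements merged into one kernel-verified Lean document; each statement's English description precedes it below -/
import Mathlib

section
/- Let (R, m) be a one-dimensional far-flung Gorenstein local ring satisfying conditions (a)-(d) with Cohen-Macaulay type 2. Then R has minimal multiplicity, and e(R) = 3. -/
set_option synthInstance.maxHeartbeats 400000

open IsLocalRing CategoryTheory

universe u

/-- `C ⊆ Q(R)` is a fractional canonical ideal of `R`: it is a finitely generated
`R`-submodule of the total quotient ring which is dualizing for fractional ideals,
i.e. `C : (C : I) = I` for every fractional ideal `I`. -/
def IsCanonicalIdeal (R : Type u) [CommRing R] (C : Submodule R (FractionRing R)) : Prop :=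
  C.FG ∧ ∀ I : Submodule R (FractionRing R), I.FG →
    (∃ r ∈ nonZeroDivisors R, algebraMap R (FractionRing R) r ∈ I) → C / (C / I) = I

section Length

variable {R M : Type*} [CommRing R] [AddCommGroup M] [Module R M]

/-- Length of a quotient along a chain `N ≤ P ≤ M`. -/
lemma length_quotient_eq_add_length_map {N P : Submodule R M} (h : N ≤ P) :
    Module.length R (M ⧸ N) =
      Module.length R (P.map N.mkQ) + Module.length R (M ⧸ P) := by
  refine Module.length_eq_add_of_exact (P.map N.mkQ).subtype (Submodule.factor h)
    (Submodule.subtype_injective _) (Submodule.factor_surjective h) ?_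
  intro y
  obtain ⟨x, rfl⟩ := N.mkQ_surjective y
  rw [Submodule.factor_mk, Submodule.mkQ_apply, Submodule.mkQ_apply, Submodule.Quotient.mk_eq_zero,
    Submodule.coe_subtype, Subtype.range_coe_subtype]
  constructor
  · exact fun hx ↦ ⟨x, hx, rfl⟩
  · rintro ⟨z, hz, hzx⟩
    have := h ((Submodule.Quotient.eq N).mp hzx)
    simpa using P.sub_mem hz this

lemma length_quotient_map_eq_add (f : M →ₗ[R] M) (hf : Function.Injective f)
    (N : Submodule R M) :
    Module.length R (M ⧸ N.map f) =
      Module.length R (M ⧸ N) + Module.length R (M ⧸ LinearMap.range f) := by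
  have hle : N.map f ≤ LinearMap.range f := LinearMap.map_le_range
  refine Module.length_eq_add_of_exact (N.mapQ (N.map f) f (Submodule.le_comap_map f N))
    (Submodule.factor hle) ?_ (Submodule.factor_surjective hle) ?_
  · rw [← LinearMap.ker_eq_bot, Submodule.ker_mapQ,
      Submodule.comap_map_eq_of_injective hf, Submodule.mkQ_map_self]
  · intro y
    obtain ⟨x, rfl⟩ := Submodule.mkQ_surjective _ y
    rw [Submodule.factor_mk, Submodule.mkQ_apply, Submodule.mkQ_apply,
      Submodule.Quotient.mk_eq_zero, Set.mem_range]
    constructor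
    · rintro ⟨z, rfl⟩
      exact ⟨Submodule.Quotient.mk z, by simp⟩
    · rintro ⟨z, hz⟩
      obtain ⟨z, rfl⟩ := Submodule.mkQ_surjective _ z
      rw [Submodule.mkQ_apply, Submodule.mapQ_apply, Submodule.Quotient.eq] at hz
      have := (LinearMap.range f).sub_mem (LinearMap.mem_range_self f z) (hle hz)
      simpa using this

/-- The length of `M / f M` is unchanged on passing to an `f`-stable submodule of finite
colength. -/
lemma length_quotient_range_eq_of_stable (f : M →ₗ[R] M) (hf : Function.Injective f)
    (N : Submodule R M) (hN : N.map f ≤ N) (hfin : Module.length R (M ⧸ N) ≠ ⊤) :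
    Module.length R (N.map (N.map f).mkQ) =
      Module.length R (M ⧸ LinearMap.range f) := by
  have h₁ := length_quotient_map_eq_add f hf N
  rw [length_quotient_eq_add_length_map hN, add_comm] at h₁
  exact (ENat.add_right_injective_of_ne_top hfin) h₁

lemma length_le_of_span_eq_top (I : Ideal R) {n : ℕ} (v : Fin n → M)
    (hv : Submodule.span R (Set.range v) = ⊤) (hM : ∀ r ∈ I, ∀ x : M, r • x = 0) :
    Module.length R M ≤ n * Module.length R (R ⧸ I) := by
  have hsurj : Function.Surjective (Fintype.linearCombination R v) := by
    rw [← LinearMap.range_eq_top, Fintype.range_linearCombination, hv]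
  let P : Submodule R (Fin n → R) := Submodule.pi Set.univ fun _ ↦ I
  have hP : P ≤ LinearMap.ker (Fintype.linearCombination R v) := by
    intro x hx
    rw [LinearMap.mem_ker, Fintype.linearCombination_apply]
    exact Finset.sum_eq_zero fun i _ ↦ hM _ (hx i (Set.mem_univ i)) _
  have hlen : Module.length R ((Fin n → R) ⧸ P) = n * Module.length R (R ⧸ I) := by
    rw [(Submodule.quotientPi fun _ : Fin n ↦ I).length_eq, Module.length_pi]
    simp
  rw [← hlen]
  refine Module.length_le_of_surjective (P.liftQ _ hP) fun x ↦ ?_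
  obtain ⟨y, rfl⟩ := hsurj x
  exact ⟨Submodule.Quotient.mk y, by simp⟩

lemma length_quotient_maximalIdeal [IsLocalRing R] :
    Module.length R (R ⧸ maximalIdeal R) = 1 := by
  rw [Module.length_eq_one_iff, isSimpleModule_iff_isCoatom]
  exact (maximalIdeal.isMaximal R).out

lemma length_quotient_span_singleton_ne_top [IsNoetherianRing R] (hdim : ringKrullDim R ≤ 1)
    {c : R} (hc : c ∈ nonZeroDivisors R) : Module.length R (R ⧸ Ideal.span {c}) ≠ ⊤ := by
  have h := (ringKrullDim_quotient_succ_le_of_nonZeroDivisor hc).trans hdim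
  have h0 : ringKrullDim (R ⧸ Ideal.span {c}) ≤ (0 : ℕ) := by
    rw [← ENat.WithBot.add_le_add_one_right_iff]
    simpa using h
  have : IsArtinianRing (R ⧸ Ideal.span {c}) :=
    isArtinianRing_iff_isNoetherianRing_krullDimLE_zero.mpr
      ⟨Ideal.Quotient.isNoetherianRing _, Ring.krullDimLE_iff.mpr h0⟩
  rw [Module.length_eq_of_surjective (S := R) (R := R ⧸ Ideal.span {c})
    Ideal.Quotient.mk_surjective]
  exact Module.length_ne_top

lemma length_ne_top_of_smul_eq_zero [IsNoetherianRing R] [Module.Finite R M]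
    (hdim : ringKrullDim R ≤ 1) {c : R} (hc : c ∈ nonZeroDivisors R) (hM : ∀ x : M, c • x = 0) :
    Module.length R M ≠ ⊤ := by
  obtain ⟨n, v, hv⟩ := Module.Finite.exists_fin (R := R) (M := M)
  refine ne_top_of_le_ne_top (WithTop.mul_ne_top (ENat.natCast_ne_top n)
    (length_quotient_span_singleton_ne_top hdim hc))
    (length_le_of_span_eq_top (Ideal.span {c}) v hv fun r hr x ↦ ?_)
  obtain ⟨d, rfl⟩ := Ideal.mem_span_singleton'.mp hr
  rw [mul_smul, hM, smul_zero]

end Length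

section Fractional

variable {R : Type u} [CommRing R]

lemma Submodule.div_div_eq_div_mul' {A : Type*} [CommRing A] [Algebra R A]
    (I J K : Submodule R A) : I / J / K = I / (J * K) := by
  refine eq_of_forall_le_iff fun L ↦ ?_
  rw [Submodule.le_div_iff_mul_le, Submodule.le_div_iff_mul_le, Submodule.le_div_iff_mul_le,
    mul_assoc, mul_comm K J]

lemma Submodule.le_div_comm {A : Type*} [CommRing A] [Algebra R A] {I J K : Submodule R A} :
    I ≤ K / J ↔ J ≤ K / I := by
  rw [Submodule.le_div_iff_mul_le, Submodule.le_div_iff_mul_le, mul_comm]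

lemma Submodule.div_div_div_self {A : Type*} [CommRing A] [Algebra R A]
    (I J : Submodule R A) : I / (I / (I / J)) = I / J := by
  refine le_antisymm ?_ (Submodule.le_div_comm.mp le_rfl)
  have h : J ≤ I / (I / J) := Submodule.le_div_comm.mp le_rfl
  exact Submodule.le_div_comm.mp (h.trans (Submodule.le_div_comm.mp le_rfl))

lemma IsCanonicalIdeal.div_self {C : Submodule R (FractionRing R)} (hC : IsCanonicalIdeal R C) :
    C / C = 1 := by
  have h := hC.2 1 ⟨{1}, by simp [Submodule.one_eq_span]⟩ ⟨1, one_mem _, by simp⟩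
  have h1 : C / 1 = C := by
    refine eq_of_forall_le_iff fun L ↦ ?_
    rw [Submodule.le_div_iff_mul_le, mul_one]
  rwa [h1] at h

/-- If the trace `(R : C) C` of a canonical ideal is `R : B` for a finite birational
extension `B ⊇ C`, then `C² = B`. -/
lemma IsCanonicalIdeal.mul_self_eq [IsNoetherianRing R] {C : Submodule R (FractionRing R)}
    (hC : IsCanonicalIdeal R C) (hRC : 1 ≤ C)
    (B : Subalgebra R (FractionRing R)) (hCB : C ≤ Subalgebra.toSubmodule B)
    (hfin : (Subalgebra.toSubmodule B).FG)
    (htr : ((1 : Submodule R (FractionRing R)) / C) * C =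
      (1 : Submodule R (FractionRing R)) / Subalgebra.toSubmodule B) :
    C * C = Subalgebra.toSubmodule B := by
  set B' := Subalgebra.toSubmodule B
  have hmem : ∀ {I : Submodule R (FractionRing R)}, 1 ≤ I →
      ∃ r ∈ nonZeroDivisors R, algebraMap R (FractionRing R) r ∈ I :=
    fun h ↦ ⟨1, one_mem _, h (by simp)⟩
  have hBB : B' * B' = B' := B.isIdempotentElem_toSubmodule
  have hCB' : C * B' = B' := by
    refine le_antisymm ((mul_le_mul_left hCB B').trans hBB.le) ?_
    calc B' = 1 * B' := (one_mul _).symm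
      _ ≤ C * B' := mul_le_mul_left hRC B'
  have hself := hC.div_self
  have h1 : (1 : Submodule R (FractionRing R)) / C = C / (C * C) := by
    rw [← hself, Submodule.div_div_eq_div_mul']
  have h2 : (1 : Submodule R (FractionRing R)) / B' = C / B' := by
    rw [← hself, Submodule.div_div_eq_div_mul', hCB']
  have hB : C / (C / B') = B' := hC.2 B' hfin (hmem (hRC.trans hCB))
  have hCC : C / (C / (C * C)) = C * C := by
    refine hC.2 _ (hC.1.mul hC.1) (hmem ?_)
    calc (1 : Submodule R (FractionRing R)) = 1 * 1 := (one_mul _).symm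
      _ ≤ C * C := mul_le_mul' hRC hRC
  have h3 : (1 : Submodule R (FractionRing R)) / (1 / C) = B' := by
    rw [← hB, ← h2, ← htr, mul_comm, ← Submodule.div_div_eq_div_mul', hself]
  rw [← hCC, ← h1, ← Submodule.div_div_div_self 1 C, h3, h2, hB]

end Fractional

section ExtSocle

/-- A linear map with values divisible by a nonzerodivisor `a` is `a` times a linear map. -/
lemma exists_eq_smul_linearMap {R : Type*} [CommRing R] {a : R} (ha : a ∈ nonZeroDivisors R)
    {M : Type*} [AddCommGroup M] [Module R M] (f : M →ₗ[R] R) (hf : ∀ x, a ∣ f x) :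
    ∃ g : M →ₗ[R] R, ∀ x, f x = a * g x := by
  choose g hg using hf
  have hcancel {x y : R} (h : a * x = a * y) : x = y :=
    (mul_cancel_left_mem_nonZeroDivisors ha).mp h
  refine ⟨⟨⟨g, fun x y ↦ hcancel ?_⟩, fun r x ↦ hcancel ?_⟩, hg⟩
  · rw [← hg, map_add, hg x, hg y, mul_add]
  · simp only [RingHom.id_apply, smul_eq_mul]
    rw [← hg, map_smul, smul_eq_mul, hg x, mul_left_comm]

variable {R : Type u} [CommRing R] [IsLocalRing R]

/-- The ideal `(a) : 𝔪`. -/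
def colonMaximalIdeal (a : R) : Ideal R where
  carrier := {t | ∀ r ∈ maximalIdeal R, a ∣ r * t}
  add_mem' hs ht r hr := by simpa [mul_add] using dvd_add (hs r hr) (ht r hr)
  zero_mem' r _ := by simp
  smul_mem' c t ht r hr := by
    simpa [smul_eq_mul, mul_left_comm] using (ht r hr).mul_left c

/-- For a projective presentation `P₂ → P₁ → P₀ → k → 0` of the residue field, evaluation at a
suitable element of `P₁` identifies one-cocycles modulo coboundaries with the socle of `R / (a)`. -/
lemma exists_cocycle_evaluation {a : R} (ham : a ∈ maximalIdeal R) (ha : a ∈ nonZeroDivisors R)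
    {P₀ P₁ P₂ : Type*} [AddCommGroup P₀] [AddCommGroup P₁] [AddCommGroup P₂]
    [Module R P₀] [Module R P₁] [Module R P₂] [Module.Projective R P₀]
    (d₂ : P₂ →ₗ[R] P₁) (d₁ : P₁ →ₗ[R] P₀) (ε : P₀ →ₗ[R] ResidueField R)
    (h₂ : Function.Exact d₂ d₁) (h₁ : Function.Exact d₁ ε) (hε : Function.Surjective ε) :
    ∃ w : P₁,
      (∀ φ : P₁ →ₗ[R] R, (∀ x, φ (d₂ x) = 0) → φ w ∈ colonMaximalIdeal a ∧
        (a ∣ φ w ↔ ∃ ψ : P₀ →ₗ[R] R, ∀ x, φ x = ψ (d₁ x))) ∧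
      ∀ t ∈ colonMaximalIdeal a, ∃ φ : P₁ →ₗ[R] R, (∀ x, φ (d₂ x) = 0) ∧ a ∣ φ w - t := by
  have hcancel {x y : R} (h : a * x = a * y) : x = y :=
    (mul_cancel_left_mem_nonZeroDivisors ha).mp h
  have hkill (r : R) (hr : r ∈ maximalIdeal R) (y : ResidueField R) : r • y = 0 := by
    rw [Algebra.smul_def, ResidueField.algebraMap_eq, (residue_eq_zero_iff r).mpr hr, zero_mul]
  have hrange (r : R) (hr : r ∈ maximalIdeal R) (p : P₀) : ∃ x, d₁ x = r • p :=
    (h₁ _).mp (by rw [map_smul, hkill r hr])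
  obtain ⟨s, hs⟩ : ∃ s : P₀ →ₗ[R] P₁, ∀ p, d₁ (s p) = a • p := by
    let f : P₀ →ₗ[R] LinearMap.range d₁ :=
      (LinearMap.lsmul R P₀ a).codRestrict _ fun p ↦ hrange a ham p
    obtain ⟨s, hs⟩ := Module.projective_lifting_property d₁.rangeRestrict f
      d₁.surjective_rangeRestrict
    exact ⟨s, fun p ↦ congrArg Subtype.val (LinearMap.congr_fun hs p)⟩
  have hsd (φ : P₁ →ₗ[R] R) (hφ : ∀ x, φ (d₂ x) = 0) (x : P₁) : φ (s (d₁ x)) = a * φ x := by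
    obtain ⟨y, hy⟩ := (h₂ (s (d₁ x) - a • x)).mp (by rw [map_sub, hs, map_smul, sub_self])
    have := hφ y
    rwa [hy, map_sub, map_smul, sub_eq_zero] at this
  obtain ⟨u, hu⟩ := hε 1
  have hdecomp (p : P₀) : ∃ (r : R) (x : P₁), p = r • u + d₁ x := by
    obtain ⟨r, hr⟩ := residue_surjective (ε p)
    obtain ⟨x, hx⟩ := (h₁ (p - r • u)).mp (by
      rw [map_sub, map_smul, hu, ← hr, Algebra.smul_def, mul_one, ResidueField.algebraMap_eq,
        sub_self])
    exact ⟨r, x, by rw [hx, add_sub_cancel]⟩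
  refine ⟨s u, fun φ hφ ↦ ⟨fun r hr ↦ ?_, ?_, ?_⟩, fun t ht ↦ ?_⟩
  · obtain ⟨x, hx⟩ := hrange r hr u
    exact ⟨φ x, by rw [← hsd φ hφ, hx, map_smul, map_smul, smul_eq_mul]⟩
  · intro hdvd
    obtain ⟨ψ, hψ⟩ := exists_eq_smul_linearMap ha (φ ∘ₗ s) fun p ↦ by
      obtain ⟨r, x, rfl⟩ := hdecomp p
      rw [LinearMap.comp_apply, map_add, map_add, hsd φ hφ, map_smul, map_smul]
      exact dvd_add (hdvd.mul_left r) (dvd_mul_right a _)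
    exact ⟨ψ, fun x ↦ hcancel (by rw [← hsd φ hφ, ← hψ, LinearMap.comp_apply])⟩
  · rintro ⟨ψ, hψ⟩
    exact ⟨ψ u, by rw [hψ, hs, map_smul, smul_eq_mul]⟩
  · let g : ResidueField R →ₗ[R] R ⧸ Ideal.span {a} :=
      Submodule.liftQ (maximalIdeal R)
        (LinearMap.toSpanSingleton R (R ⧸ Ideal.span {a}) (Ideal.Quotient.mk _ t)) fun r hr ↦ by
          rw [LinearMap.mem_ker, LinearMap.toSpanSingleton_apply, Algebra.smul_def,
            Ideal.Quotient.algebraMap_eq, ← map_mul, Ideal.Quotient.eq_zero_iff_dvd]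
          exact ht r hr
    have hg : g 1 = Ideal.Quotient.mk _ t := by
      change (1 : R) • (Ideal.Quotient.mk (Ideal.span {a}) t) = _
      rw [one_smul]
    obtain ⟨h, hh⟩ := Module.projective_lifting_property
      (Submodule.mkQ (Ideal.span {a})) (g ∘ₗ ε) (Submodule.mkQ_surjective _)
    have hh' (p : P₀) : Ideal.Quotient.mk (Ideal.span {a}) (h p) = g (ε p) :=
      LinearMap.congr_fun hh p
    obtain ⟨φ, hφ⟩ := exists_eq_smul_linearMap ha (h ∘ₗ d₁) fun x ↦ by
      rw [← Ideal.Quotient.eq_zero_iff_dvd, LinearMap.comp_apply, hh', h₁.apply_apply_eq_zero,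
        map_zero]
    refine ⟨φ, fun x ↦ hcancel ?_, ?_⟩
    · rw [← hφ, LinearMap.comp_apply, h₂.apply_apply_eq_zero, map_zero, mul_zero]
    · have : φ (s u) = h u := hcancel (by
        rw [← hφ, LinearMap.comp_apply, hs, map_smul, smul_eq_mul])
      rw [this, ← Ideal.Quotient.eq_zero_iff_dvd, map_sub, hh', hu, hg, sub_self]

/-- `Ext¹(k, R)` is isomorphic to the socle of `R / (a)`. -/
lemma nonempty_ext_one_equiv_socle {a : R} (ham : a ∈ maximalIdeal R)
    (ha : a ∈ nonZeroDivisors R) :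
    Nonempty ((((Ext R (ModuleCat.{u} R) 1).obj
        (Opposite.op (ModuleCat.of R (ResidueField R)))).obj (ModuleCat.of R R)) ≃ₗ[R]
      Submodule.map (Submodule.mkQ (Ideal.span {a})) (colonMaximalIdeal a)) := by
  let P := projectiveResolution (ModuleCat.of R (ResidueField R))
  have hproj : Module.Projective R (P.complex.X 0) :=
    (IsProjective.iff_projective _).mpr (P.projective 0)
  have h₂ : Function.Exact (P.complex.d 2 1).hom (P.complex.d 1 0).hom :=
    (ShortComplex.ShortExact.moduleCat_exact_iff_function_exact _).mp (P.exact_succ 0)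
  have h₁ : Function.Exact (P.complex.d 1 0).hom (P.π.f 0).hom :=
    (ShortComplex.ShortExact.moduleCat_exact_iff_function_exact _).mp P.exact₀
  have hε : Function.Surjective (P.π.f 0).hom :=
    (ModuleCat.epi_iff_surjective _).mp inferInstance
  obtain ⟨w, hw, hsurj⟩ := exists_cocycle_evaluation ham ha _ _ (P.π.f 0).hom h₂ h₁ hε
  let K := P.complex.linearYonedaObj R (ModuleCat.of R R)
  let S := K.sc' 0 1 2
  let θ₀ : (P.complex.X 1 ⟶ ModuleCat.of R R) →ₗ[R] R ⧸ Ideal.span {a} :=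
    Submodule.mkQ (Ideal.span {a}) ∘ₗ
      { toFun := fun φ ↦ φ.hom w
        map_add' := fun _ _ ↦ rfl
        map_smul' := fun _ _ ↦ rfl }
  let θ : LinearMap.ker S.g.hom →ₗ[R] R ⧸ Ideal.span {a} := θ₀ ∘ₗ (LinearMap.ker S.g.hom).subtype
  have hg (φ : P.complex.X 1 ⟶ ModuleCat.of R R) :
      S.g.hom φ = 0 ↔ ∀ x, φ.hom ((P.complex.d 2 1).hom x) = 0 := by
    change P.complex.d 2 1 ≫ φ = 0 ↔ _
    rw [ModuleCat.hom_ext_iff, LinearMap.ext_iff]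
    rfl
  have hrange : LinearMap.range θ =
      Submodule.map (Submodule.mkQ (Ideal.span {a})) (colonMaximalIdeal a) := by
    ext y
    constructor
    · rintro ⟨φ, rfl⟩
      exact ⟨φ.1.hom w, (hw φ.1.hom ((hg φ.1).mp φ.2)).1, rfl⟩
    · rintro ⟨t, ht, rfl⟩
      obtain ⟨φ, hφ, hφw⟩ := hsurj t ht
      refine ⟨⟨ModuleCat.ofHom φ, (hg _).mpr hφ⟩, ?_⟩
      exact (Submodule.Quotient.eq _).mpr (Ideal.mem_span_singleton.mpr hφw)
  have hkerθ : LinearMap.range S.moduleCatToCycles = LinearMap.ker θ := by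
    ext φ
    have hφ : φ ∈ LinearMap.ker θ ↔ a ∣ φ.1.hom w := by
      rw [← Ideal.mem_span_singleton, ← Submodule.Quotient.mk_eq_zero (Ideal.span {a})]
      rfl
    rw [hφ, (hw φ.1.hom ((hg φ.1).mp φ.2)).2]
    constructor
    · rintro ⟨ψ, rfl⟩
      exact ⟨(show P.complex.X 0 ⟶ ModuleCat.of R R from ψ).hom, fun _ ↦ rfl⟩
    · rintro ⟨ψ, hψ⟩
      refine ⟨(ModuleCat.ofHom ψ : P.complex.X 0 ⟶ ModuleCat.of R R), Subtype.ext ?_⟩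
      exact ModuleCat.hom_ext (LinearMap.ext fun x ↦ (hψ x).symm)
  exact ⟨(P.isoExt 1 (ModuleCat.of R R)).toLinearEquiv ≪≫ₗ
    (K.homologyIsoSc' 0 1 2 (by simp) (by simp)).toLinearEquiv ≪≫ₗ
    S.moduleCatHomologyIso.toLinearEquiv ≪≫ₗ
    Submodule.quotEquivOfEq _ _ hkerθ ≪≫ₗ θ.quotKerEquivRange ≪≫ₗ
    LinearEquiv.ofEq _ _ hrange⟩

end ExtSocle

section TwoGenerated

variable {R : Type u} [CommRing R] [IsNoetherianRing R] [IsLocalRing R]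

/-- If the socle of `R / (a)` has length two, then a canonical ideal containing `R` is generated
by two elements. -/
lemma IsCanonicalIdeal.exists_eq_span_pair {C : Submodule R (FractionRing R)}
    (hC : IsCanonicalIdeal R C) (hRC : 1 ≤ C) {a : R} (ham : a ∈ maximalIdeal R)
    (ha : a ∈ nonZeroDivisors R) (hfin : Module.length R (R ⧸ Ideal.span {a}) ≠ ⊤)
    (hlen : Module.length R (R ⧸ Ideal.span {a}) =
      2 + Module.length R (R ⧸ colonMaximalIdeal a)) :
    ∃ x y, C = Submodule.span R {x, y} := by
  let X := maximalIdeal R • C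
  have hXC : X ≤ C := Submodule.smul_le_right
  have hinj : Function.Injective (algebraMap R (FractionRing R)) :=
    IsFractionRing.injective R (FractionRing R)
  have hunit : IsUnit (algebraMap R (FractionRing R) a) :=
    IsLocalization.map_units _ (⟨a, ha⟩ : nonZeroDivisors R)
  suffices h : ∃ x ∈ C, ∃ y ∈ C, C ≤ Submodule.span R {x, y} ⊔ X by
    obtain ⟨x, hx, y, hy, hxy⟩ := h
    refine ⟨x, y, le_antisymm ?_ ?_⟩
    · exact Submodule.le_of_le_smul_of_le_jacobson_bot hC.1
        (IsLocalRing.maximalIdeal_le_jacobson ⊥) hxy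
    · rw [Submodule.span_le]
      rintro z (rfl | rfl) <;> assumption
  let J (N : Submodule R (FractionRing R)) : Ideal R :=
    ((C / N).map (LinearMap.lsmul R (FractionRing R) a)).comap (Algebra.linearMap R _)
  have hmemJ (N : Submodule R (FractionRing R)) (t : R) :
      t ∈ J N ↔ ∃ d ∈ C / N, algebraMap R (FractionRing R) a * d = algebraMap R _ t := by
    simp only [J, Submodule.mem_comap, Submodule.mem_map, LinearMap.lsmul_apply,
      Algebra.linearMap_apply, Algebra.smul_def]
  have hself := hC.div_self
  have hX {d : FractionRing R} (hd : d ∈ C / X) {r : R} (hr : r ∈ maximalIdeal R) :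
      ∃ s : R, algebraMap R (FractionRing R) s = algebraMap R _ r * d := by
    have : algebraMap R (FractionRing R) r * d ∈ C / C := by
      refine Submodule.mem_div_iff_forall_mul_mem.mpr fun z hz ↦ ?_
      have := Submodule.mem_div_iff_forall_mul_mem.mp hd _ (Submodule.smul_mem_smul hr hz)
      rwa [Algebra.smul_def, mul_left_comm, ← mul_assoc] at this
    rw [hself] at this
    exact Submodule.mem_one.mp this
  have hdual {N : Submodule R (FractionRing R)} (h1 : X ≤ N) (h2 : N ≤ C) :
      C / (C / N) = N := by
    refine hC.2 N ((isNoetherian_submodule.mp (isNoetherian_of_fg_of_noetherian C hC.1)) N h2)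
      ⟨a, ha, h1 ?_⟩
    have : a • (1 : FractionRing R) ∈ X :=
      Submodule.smul_mem_smul ham (hRC (Submodule.mem_one.mpr ⟨1, by simp⟩))
    rwa [Algebra.smul_def, mul_one] at this
  have hstrict {N N' : Submodule R (FractionRing R)} (h1 : X ≤ N) (h : N < N') (h2 : N' ≤ C) :
      J N' < J N := by
    refine lt_of_le_not_ge (fun t ht ↦ ?_) fun hle ↦ h.not_ge ?_
    · obtain ⟨d, hd, hdt⟩ := (hmemJ _ _).mp ht
      refine (hmemJ _ _).mpr ⟨d, ?_, hdt⟩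
      exact Submodule.mem_div_iff_forall_mul_mem.mpr fun z hz ↦
        Submodule.mem_div_iff_forall_mul_mem.mp hd z (h.le hz)
    · rw [← hdual h1 (h.le.trans h2), Submodule.le_div_comm]
      intro d hd
      have hdX : d ∈ C / X := Submodule.mem_div_iff_forall_mul_mem.mpr fun z hz ↦
        Submodule.mem_div_iff_forall_mul_mem.mp hd z (h1 hz)
      obtain ⟨t, ht⟩ := hX hdX ham
      obtain ⟨d', hd', hdt⟩ := (hmemJ _ _).mp (hle ((hmemJ _ _).mpr ⟨d, hd, ht.symm⟩))
      rwa [← hunit.mul_left_cancel (hdt.trans ht)]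
  have hJC : Ideal.span {a} ≤ J C := by
    rw [Ideal.span_singleton_le_iff_mem, hmemJ, hself]
    exact ⟨1, Submodule.mem_one.mpr ⟨1, map_one _⟩, mul_one _⟩
  have hJX : J X ≤ colonMaximalIdeal a := by
    intro t ht r hr
    obtain ⟨d, hd, hdt⟩ := (hmemJ _ _).mp ht
    obtain ⟨s, hs⟩ := hX hd hr
    exact ⟨s, hinj (by rw [map_mul, map_mul, hs, ← hdt, mul_left_comm])⟩
  by_contra! hne
  have hstep (x : FractionRing R) (hx : x ∈ C) (y : FractionRing R) (hy : y ∈ C) :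
      Submodule.span R {x, y} ⊔ X < C := by
    refine lt_of_le_not_ge (sup_le ?_ hXC) (hne x hx y hy)
    rw [Submodule.span_le]
    rintro z (rfl | rfl) <;> assumption
  have h0 := hstep 0 C.zero_mem 0 C.zero_mem
  obtain ⟨x, hx, hxX⟩ := SetLike.exists_of_lt h0
  obtain ⟨y, hy, hyX⟩ := SetLike.exists_of_lt (hstep x hx x hx)
  simp only [Set.pair_eq_singleton, Submodule.span_zero_singleton, bot_sup_eq] at h0 hxX hyX
  have hlt₁ : X < Submodule.span R {x} ⊔ X :=
    lt_of_le_not_ge le_sup_right fun h ↦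
      hxX (h (le_sup_left (a := Submodule.span R {x}) (Submodule.mem_span_singleton_self x)))
  have hlt₂ : Submodule.span R {x} ⊔ X < Submodule.span R {x, y} ⊔ X :=
    lt_of_le_not_ge (sup_le_sup_right (Submodule.span_mono (by simp)) X) fun h ↦
      hyX (h (le_sup_left (a := Submodule.span R {x, y}) (Submodule.subset_span (by simp))))
  have hlt₃ := hstep x hx y hy
  have k₁ := hstrict le_rfl hlt₁ (hlt₂.trans hlt₃).le
  have k₂ := hstrict hlt₁.le hlt₂ hlt₃.le
  have k₃ := hstrict (hlt₁.trans hlt₂).le hlt₃ le_rfl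
  have c₁ := Order.coheight_add_one_le k₁
  have c₂ := Order.coheight_add_one_le k₂
  have c₃ := Order.coheight_add_one_le k₃
  have c₀ := Order.coheight_anti hJX
  have c₄ := Order.coheight_anti hJC
  rw [Module.length_quotient] at hfin hlen
  rw [Module.length_quotient] at hlen
  have hfin' : Order.coheight (colonMaximalIdeal a) ≠ ⊤ := by
    intro h
    rw [hlen, h] at hfin
    exact hfin rfl
  have : 3 + Order.coheight (colonMaximalIdeal a) ≤ 2 + Order.coheight (colonMaximalIdeal a) := by
    rw [← hlen]
    calc 3 + Order.coheight (colonMaximalIdeal a)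
        = Order.coheight (colonMaximalIdeal a) + 1 + 1 + 1 := by ring
      _ ≤ Order.coheight (J X) + 1 + 1 + 1 := by gcongr
      _ ≤ Order.coheight (Ideal.span {a}) := by
        refine le_trans ?_ (c₃.trans c₄)
        gcongr
        refine le_trans ?_ c₂
        gcongr
  exact absurd ((ENat.add_le_add_iff_right hfin').mp this) (by decide)

end TwoGenerated

section Multiplicity

variable {R : Type u} [CommRing R]

lemma lsmul_injective_of_mem_nonZeroDivisors {a : R} (ha : a ∈ nonZeroDivisors R) :
    Function.Injective (LinearMap.lsmul R R a) :=
  fun _ _ h ↦ (mul_cancel_left_mem_nonZeroDivisors ha).mp h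

lemma range_lsmul_eq_span_singleton (a : R) :
    LinearMap.range (LinearMap.lsmul R R a) = Ideal.span {a} := by
  ext x
  rw [Ideal.mem_span_singleton, LinearMap.mem_range]
  exact ⟨fun ⟨y, hy⟩ ↦ ⟨y, hy.symm⟩, fun ⟨y, hy⟩ ↦ ⟨y, hy.symm⟩⟩

lemma length_quotient_span_singleton_mul {a : R} (ha : a ∈ nonZeroDivisors R) (I : Ideal R) :
    Module.length R (R ⧸ Ideal.span {a} * I) =
      Module.length R (R ⧸ I) + Module.length R (R ⧸ Ideal.span {a}) := by
  have hI : Submodule.map (LinearMap.lsmul R R a) I = Ideal.span {a} * I := by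
    ext x
    rw [Ideal.mem_span_singleton_mul]
    rfl
  have := length_quotient_map_eq_add _ (lsmul_injective_of_mem_nonZeroDivisors ha) I
  rwa [hI, range_lsmul_eq_span_singleton] at this

/-- The leading coefficient of the Hilbert–Samuel polynomial is the colength of a principal
reduction. -/
lemma length_quotient_reduction_eq_leadingCoeff [IsLocalRing R] {a : R}
    (ha : a ∈ nonZeroDivisors R) {n : ℕ}
    (hn : maximalIdeal R ^ (n + 1) = Ideal.span {a} * maximalIdeal R ^ n)
    (p : Polynomial ℚ) (hpdeg : p.natDegree = 1)
    (hHilb : ∃ N : ℕ, ∀ n ≥ N,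
      ∃ s : CompositionSeries (Submodule R (R ⧸ (maximalIdeal R ^ n))),
        s.head = ⊥ ∧ s.last = ⊤ ∧ (s.length : ℚ) = p.eval (n : ℚ))
    (e : ℕ) (he : (e : ℚ) = p.leadingCoeff) :
    Module.length R (R ⧸ Ideal.span {a}) = e := by
  obtain ⟨N, hN⟩ := hHilb
  have hk : maximalIdeal R ^ (n + N + 1) = Ideal.span {a} * maximalIdeal R ^ (n + N) := by
    rw [add_right_comm, pow_add, hn, mul_assoc, ← pow_add]
  obtain ⟨s, hs₀, hs₁, hs⟩ := hN (n + N) (by lia)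
  obtain ⟨t, ht₀, ht₁, ht⟩ := hN (n + N + 1) (by lia)
  have hlen := length_quotient_span_singleton_mul ha (maximalIdeal R ^ (n + N))
  rw [← hk, ← Module.length_compositionSeries s hs₀ hs₁,
    ← Module.length_compositionSeries t ht₀ ht₁] at hlen
  have hst : t.length = s.length + e := by
    have hlc : p.leadingCoeff = p.coeff 1 := by rw [Polynomial.leadingCoeff, hpdeg]
    rw [Polynomial.eq_X_add_C_of_natDegree_le_one hpdeg.le] at hs ht
    simp only [Polynomial.eval_add, Polynomial.eval_mul, Polynomial.eval_C, Polynomial.eval_X,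
      ← hlc, ← he] at hs ht
    have : (t.length : ℚ) = s.length + e := by
      rw [hs, ht]
      push_cast
      ring
    exact_mod_cast this
  rw [hst, Nat.cast_add] at hlen
  exact (ENat.add_right_injective_of_ne_top (ENat.natCast_ne_top s.length) hlen).symm

/-- An element stabilizing a Noetherian submodule that contains a unit is integral. -/
lemma isIntegral_of_mul_mem_of_isUnit {A : Type*} [CommRing A] [Algebra R A]
    (N : Submodule R A) [IsNoetherian R N] {u : A} (hu : IsUnit u) (huN : u ∈ N) {y : A}
    (hy : ∀ z ∈ N, y * z ∈ N) : IsIntegral R y := by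
  let S : Subalgebra R A :=
    { carrier := {x | ∀ z ∈ N, x * z ∈ N}
      mul_mem' := fun hx hx' z hz ↦ by
        rw [mul_assoc]
        exact hx _ (hx' z hz)
      one_mem' := fun z hz ↦ by rwa [one_mul]
      add_mem' := fun hx hx' z hz ↦ by
        rw [add_mul]
        exact N.add_mem (hx z hz) (hx' z hz)
      zero_mem' := fun z _ ↦ by simp
      algebraMap_mem' := fun r z hz ↦ by
        rw [← Algebra.smul_def]
        exact N.smul_mem r hz }
  let f : Subalgebra.toSubmodule S →ₗ[R] N :=
    (LinearMap.mulRight R u).restrict fun _ hx ↦ hx u huN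
  have hf : Function.Injective f := fun x x' h ↦
    Subtype.ext (hu.mul_right_cancel (congrArg Subtype.val h))
  exact isIntegral_of_submodule_noetherian S (isNoetherian_of_injective f hf) y hy

/-- If `(a)` is a reduction of an ideal `I` containing `a`, then every element of `I` is `a` times
an element integral over `R`. -/
lemma exists_mem_integralClosure_mul_eq [IsNoetherianRing R] {a : R}
    (ha : a ∈ nonZeroDivisors R) {I : Ideal R} (haI : a ∈ I) {n : ℕ}
    (hn : I ^ (n + 1) = Ideal.span {a} * I ^ n) {x : R} (hx : x ∈ I) :
    ∃ y ∈ integralClosure R (FractionRing R),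
      algebraMap R (FractionRing R) x = algebraMap R (FractionRing R) a * y := by
  let Q := FractionRing R
  let b : nonZeroDivisors R := ⟨a, ha⟩
  let y : Q := IsLocalization.mk' Q x b
  have hy : algebraMap R Q a * y = algebraMap R Q x := IsLocalization.mk'_spec' Q x b
  have hunit : IsUnit (algebraMap R Q a) := IsLocalization.map_units _ b
  refine ⟨y, ?_, hy.symm⟩
  let N : Submodule R Q := Submodule.map (Algebra.linearMap R Q) (I ^ n)
  have : IsNoetherian R N :=
    isNoetherian_of_fg_of_noetherian N ((IsNoetherian.noetherian (I ^ n)).map _)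
  have hanN : algebraMap R Q a ^ n ∈ N :=
    ⟨a ^ n, Ideal.pow_mem_pow haI n, (algebraMap R Q).map_pow a n⟩
  refine isIntegral_of_mul_mem_of_isUnit N (hunit.pow n) hanN ?_
  rintro _ ⟨z, hz, rfl⟩
  have hxz : x * z ∈ Ideal.span {a} * I ^ n := by
    rw [← hn, pow_succ']
    exact Ideal.mul_mem_mul hx hz
  obtain ⟨w, hw, hwz⟩ := Ideal.mem_span_singleton_mul.mp hxz
  refine ⟨w, hw, hunit.mul_left_cancel ?_⟩
  rw [Algebra.linearMap_apply, Algebra.linearMap_apply, ← mul_assoc, hy, ← map_mul, ← map_mul, hwz]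

/-- The colength of a nonzerodivisor `a` can be computed on a finite birational extension. -/
lemma length_quotient_span_singleton_eq_of_birational [IsNoetherianRing R]
    (hdim : ringKrullDim R ≤ 1) {a : R} (ha : a ∈ nonZeroDivisors R)
    (B : Subalgebra R (FractionRing R)) [Module.Finite R B] :
    Module.length R (R ⧸ Ideal.span {a}) =
      Module.length R (B ⧸ LinearMap.range (LinearMap.lsmul R B a)) := by
  let ι : R →ₗ[R] B := Algebra.linearMap R B
  have hι : Function.Injective ι := fun x y h ↦
    IsFractionRing.injective R (FractionRing R) (congrArg Subtype.val h)
  have hf : Function.Injective (LinearMap.lsmul R B a) := fun x y h ↦ by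
    have h' := congrArg Subtype.val h
    simp only [LinearMap.lsmul_apply, Algebra.smul_def] at h'
    have hunit : IsUnit (algebraMap R (FractionRing R) a) :=
      IsLocalization.map_units _ (⟨a, ha⟩ : nonZeroDivisors R)
    exact Subtype.ext (hunit.mul_left_cancel h')
  let N : Submodule R B := LinearMap.range ι
  have hN : N.map (LinearMap.lsmul R B a) ≤ N := by
    rintro _ ⟨x, hx, rfl⟩
    exact N.smul_mem a hx
  have hfin : Module.length R (B ⧸ N) ≠ ⊤ := by
    classical
    obtain ⟨s, hs⟩ := Module.Finite.fg_top (R := R) (M := B)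
    obtain ⟨c, hc⟩ := IsLocalization.exist_integer_multiples_of_finset (nonZeroDivisors R)
      (s.image (Subtype.val : B → FractionRing R))
    refine length_ne_top_of_smul_eq_zero hdim c.2 fun x ↦ ?_
    obtain ⟨x, rfl⟩ := N.mkQ_surjective x
    have hle : Submodule.span R (s : Set B) ≤ N.comap (LinearMap.lsmul R B (c : R)) := by
      rw [Submodule.span_le]
      intro z hz
      obtain ⟨r, hr⟩ := hc z (Finset.mem_image_of_mem _ hz)
      exact ⟨r, Subtype.ext hr⟩
    rw [hs] at hle
    rw [← map_smul, Submodule.mkQ_apply, Submodule.Quotient.mk_eq_zero]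
    exact hle Submodule.mem_top
  rw [← length_quotient_range_eq_of_stable _ hf N hN hfin]
  let ψ := (N.map (LinearMap.lsmul R B a)).mkQ ∘ₗ ι
  have hker : LinearMap.ker ψ = Ideal.span {a} := by
    ext x
    rw [LinearMap.mem_ker, LinearMap.comp_apply, Submodule.mkQ_apply,
      Submodule.Quotient.mk_eq_zero, Ideal.mem_span_singleton]
    constructor
    · rintro ⟨_, ⟨y, rfl⟩, hy⟩
      exact ⟨y, (hι (by rw [← smul_eq_mul, map_smul]; exact hy)).symm⟩
    · rintro ⟨y, rfl⟩
      exact ⟨ι y, ⟨y, rfl⟩, by rw [← smul_eq_mul, map_smul]; rfl⟩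
  have hrange : LinearMap.range ψ = N.map (N.map (LinearMap.lsmul R B a)).mkQ :=
    LinearMap.range_comp _ _
  rw [← hrange, ← hker]
  exact ψ.quotKerEquivRange.length_eq

end Multiplicity

section MinimalMultiplicity

variable {R : Type u} [CommRing R] [IsLocalRing R]

lemma length_quotient_maximalIdeal_sq [IsNoetherianRing R] :
    Module.length R (R ⧸ maximalIdeal R ^ 2) =
      Module.finrank (ResidueField R) (CotangentSpace R) + 1 := by
  have hcot : Module.length R (CotangentSpace R) =
      Module.finrank (ResidueField R) (CotangentSpace R) := by
    rw [← Module.length_eq_finrank (ResidueField R) (CotangentSpace R)]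
    exact Module.length_eq_of_surjective residue_surjective
  have hle : maximalIdeal R ^ 2 ≤ maximalIdeal R := Ideal.pow_le_self two_ne_zero
  have hrange : LinearMap.range (maximalIdeal R).cotangentToQuotientSquare =
      Submodule.map (Submodule.mkQ (maximalIdeal R ^ 2)) (maximalIdeal R) := by
    rw [← LinearMap.range_comp_of_range_eq_top _ (maximalIdeal R).toCotangent_range,
      Ideal.to_quotient_square_comp_toCotangent, LinearMap.range_comp, Submodule.range_subtype]
  rw [length_quotient_eq_add_length_map hle, length_quotient_maximalIdeal, ← hcot, ← hrange]
  congr 1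
  exact (LinearEquiv.ofInjective _
    (Ideal.cotangentToQuotientSquare_injective (maximalIdeal R))).length_eq.symm

/-- If the square of the maximal ideal lies in a principal reduction `(a)`, then it equals
`a` times the maximal ideal. -/
lemma maximalIdeal_sq_eq_span_singleton_mul [IsNoetherianRing R] {a : R}
    (ham : a ∈ maximalIdeal R) (ha : a ∈ nonZeroDivisors R) {n : ℕ}
    (hn : maximalIdeal R ^ (n + 1) = Ideal.span {a} * maximalIdeal R ^ n)
    (hsq : maximalIdeal R ^ 2 ≤ Ideal.span {a}) :
    maximalIdeal R ^ 2 = Ideal.span {a} * maximalIdeal R := by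
  have haspan : Ideal.span {a} ≤ maximalIdeal R := (Ideal.span_singleton_le_iff_mem _).mpr ham
  refine le_antisymm (fun y hy ↦ ?_) (by rw [sq]; exact Ideal.mul_mono_left haspan)
  obtain ⟨x, rfl⟩ := Ideal.mem_span_singleton.mp (hsq hy)
  refine Ideal.mul_mem_mul (Ideal.mem_span_singleton_self a) ?_
  by_contra hx
  have hxu : IsUnit x := by rwa [mem_maximalIdeal, mem_nonunits_iff, not_not] at hx
  have ha2 : a ∈ maximalIdeal R ^ 2 := (Ideal.mul_unit_mem_iff_mem _ hxu).mp hy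
  have hle : maximalIdeal R ^ (n + 1) ≤ maximalIdeal R • maximalIdeal R ^ (n + 1) := by
    calc maximalIdeal R ^ (n + 1) ≤ maximalIdeal R ^ 2 * maximalIdeal R ^ n := by
          rw [hn]
          exact Ideal.mul_mono_left ((Ideal.span_singleton_le_iff_mem _).mpr ha2)
      _ = maximalIdeal R • maximalIdeal R ^ (n + 1) := by rw [smul_eq_mul]; ring
  have hbot := Submodule.eq_bot_of_le_smul_of_le_jacobson_bot _ _
    (IsNoetherian.noetherian (maximalIdeal R ^ (n + 1))) hle (maximalIdeal_le_jacobson _)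
  have hpow : a ^ (n + 1) = 0 := by
    rw [← Ideal.mem_bot, ← hbot]
    exact Ideal.pow_mem_pow ham _
  exact nonZeroDivisors.ne_zero (pow_mem ha (n + 1)) hpow

/-- If `(a)` has colength at most three and `R / (a)` has socle of length two, then the square of
the maximal ideal lies in `(a)` and the colength is exactly three. -/
lemma length_eq_three_and_maximalIdeal_sq_le {a : R}
    (hlen : Module.length R (R ⧸ Ideal.span {a}) =
      2 + Module.length R (R ⧸ colonMaximalIdeal a))
    (hle : Module.length R (R ⧸ Ideal.span {a}) ≤ 3) (ham : a ∈ maximalIdeal R) :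
    Module.length R (R ⧸ Ideal.span {a}) = 3 ∧ maximalIdeal R ^ 2 ≤ Ideal.span {a} := by
  have hS1 : Module.length R (R ⧸ colonMaximalIdeal a) ≤ 1 := by
    rw [hlen, show (3 : ℕ∞) = 2 + 1 by norm_num] at hle
    exact (ENat.add_le_add_iff_left (by simp)).mp hle
  have hSm : colonMaximalIdeal a ≤ maximalIdeal R := by
    refine le_maximalIdeal fun htop ↦ ?_
    have hmem : (1 : R) ∈ colonMaximalIdeal a := htop ▸ Submodule.mem_top
    have hspan : Ideal.span {a} = maximalIdeal R :=
      le_antisymm ((Ideal.span_singleton_le_iff_mem _).mpr ham) fun r hr ↦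
        Ideal.mem_span_singleton.mpr (by simpa using hmem r hr)
    rw [hspan, length_quotient_maximalIdeal] at hlen
    have : (2 : ℕ∞) ≤ 1 := hlen ▸ le_self_add
    exact absurd this (by norm_num)
  have hadd := length_quotient_eq_add_length_map hSm
  rw [length_quotient_maximalIdeal] at hadd
  have hS : Module.length R (R ⧸ colonMaximalIdeal a) = 1 :=
    le_antisymm hS1 (hadd ▸ le_add_self)
  refine ⟨by rw [hlen, hS]; norm_num, ?_⟩
  have hzero : Module.length R
      (Submodule.map (Submodule.mkQ (colonMaximalIdeal a)) (maximalIdeal R)) = 0 := by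
    rw [hS] at hadd
    exact (ENat.add_left_injective_of_ne_top ENat.one_ne_top (by simpa using hadd)).symm
  rw [Module.length_eq_zero_iff, Submodule.subsingleton_iff_eq_bot, ← LinearMap.le_ker_iff_map,
    Submodule.ker_mkQ] at hzero
  rw [sq, Ideal.mul_le]
  exact fun r hr t ht ↦ Ideal.mem_span_singleton.mpr (hzero ht r hr)

/-- A ring of type two satisfies `length (R / (a)) = 2 + length (R / ((a) : 𝔪))`. -/
lemma length_quotient_eq_two_add_of_ext {a : R} (ham : a ∈ maximalIdeal R)
    (ha : a ∈ nonZeroDivisors R)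
    (hr : Nonempty ((((Ext R (ModuleCat.{u} R) 1).obj
        (Opposite.op (ModuleCat.of R (ResidueField R)))).obj (ModuleCat.of R R))
      ≃ₗ[R] (Fin 2 → ResidueField R))) :
    Module.length R (R ⧸ Ideal.span {a}) =
      2 + Module.length R (R ⧸ colonMaximalIdeal a) := by
  obtain ⟨f⟩ := hr
  obtain ⟨g⟩ := nonempty_ext_one_equiv_socle ham ha
  have hle : Ideal.span {a} ≤ colonMaximalIdeal a :=
    (Ideal.span_singleton_le_iff_mem _).mpr fun r _ ↦ dvd_mul_left a r
  have hone : Module.length R (ResidueField R) = 1 := length_quotient_maximalIdeal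
  rw [length_quotient_eq_add_length_map hle, (g.symm.trans f).length_eq, Module.length_pi, hone]
  simp

/-- If `C * C` is the integral closure of `R` with `C` generated by two elements, then a principal
reduction of the maximal ideal has colength at most three. -/
lemma length_quotient_reduction_le_three [IsNoetherianRing R] (hdim : ringKrullDim R ≤ 1) {a : R}
    (ham : a ∈ maximalIdeal R) (ha : a ∈ nonZeroDivisors R) {n : ℕ}
    (hn : maximalIdeal R ^ (n + 1) = Ideal.span {a} * maximalIdeal R ^ n)
    {x y : FractionRing R}
    (hC : Submodule.span R {x, y} * Submodule.span R {x, y} =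
      Subalgebra.toSubmodule (integralClosure R (FractionRing R))) :
    Module.length R (R ⧸ Ideal.span {a}) ≤ 3 := by
  let B := integralClosure R (FractionRing R)
  let u : Fin 3 → FractionRing R := ![x * x, x * y, y * y]
  have hspan : Submodule.span R (Set.range u) = Subalgebra.toSubmodule B := by
    rw [← hC, Submodule.span_mul_span]
    congr 1
    ext z
    simp only [u, Matrix.range_cons, Matrix.range_empty, Set.mem_mul, Set.mem_union,
      Set.mem_insert_iff, Set.mem_singleton_iff, Set.mem_empty_iff_false]
    constructor
    · rintro (rfl | rfl | rfl | h)
      · exact ⟨x, .inl rfl, x, .inl rfl, rfl⟩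
      · exact ⟨x, .inl rfl, y, .inr rfl, rfl⟩
      · exact ⟨y, .inr rfl, y, .inr rfl, rfl⟩
      · exact h.elim
    · rintro ⟨_, rfl | rfl, _, rfl | rfl, rfl⟩
      · exact .inl rfl
      · exact .inr (.inl rfl)
      · exact .inr (.inl (mul_comm _ _))
      · exact .inr (.inr (.inl rfl))
  have hmem (i : Fin 3) : u i ∈ Subalgebra.toSubmodule B :=
    hspan ▸ Submodule.subset_span (Set.mem_range_self i)
  let v : Fin 3 → B := fun i ↦ ⟨u i, hmem i⟩
  have hv : Submodule.span R (Set.range v) = ⊤ := by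
    refine Submodule.map_injective_of_injective
      (Subalgebra.toSubmodule B).injective_subtype ?_
    rw [Submodule.map_span, Submodule.map_subtype_top, ← Set.range_comp]
    exact hspan
  have : Module.Finite R B := ⟨Submodule.fg_def.mpr ⟨_, Set.finite_range v, hv⟩⟩
  rw [length_quotient_span_singleton_eq_of_birational hdim ha B]
  let N : Submodule R B := LinearMap.range (LinearMap.lsmul R B a)
  have hvN : Submodule.span R (Set.range (N.mkQ ∘ v)) = ⊤ := by
    rw [Set.range_comp, ← Submodule.map_span, hv, Submodule.map_top, Submodule.range_mkQ]
  refine (length_le_of_span_eq_top (maximalIdeal R) _ hvN fun r hr z ↦ ?_).trans ?_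
  · obtain ⟨z, rfl⟩ := N.mkQ_surjective z
    obtain ⟨w, hw, hrw⟩ := exists_mem_integralClosure_mul_eq ha ham hn hr
    rw [← map_smul, Submodule.mkQ_apply, Submodule.Quotient.mk_eq_zero]
    refine ⟨⟨w, hw⟩ * z, Subtype.ext ?_⟩
    simp only [LinearMap.lsmul_apply, Algebra.smul_def, B]
    change algebraMap R (FractionRing R) a * (w * z) = algebraMap R (FractionRing R) r * z
    rw [hrw, mul_assoc]
  · rw [length_quotient_maximalIdeal]
    norm_num

end MinimalMultiplicity

/-- Let `(R, 𝔪)` be a one-dimensional Cohen–Macaulay local ring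
satisfying conditions (a)-(d): a fractional canonical ideal `C` with `R ⊆ C ⊆ R̄`,
`R̄` module-finite over `R` and local, and `𝔪` admitting a principal reduction `(a)`
with `a` a non-zerodivisor. If `R` is far-flung Gorenstein
(`tr_R(ω_R) = (R : C)·C = R : R̄`) of Cohen–Macaulay type `2`
(`dim_{R/𝔪} Ext¹_R(R/𝔪, R) = 2`), then `R` has minimal multiplicity (in dimension one,
`e(R)` equals the embedding dimension `v(R)`), and moreover `e(R) = 3`. -/
theorem farFlungGorenstein_type_two_minimal_multiplicity
    (R : Type u) [CommRing R] [IsNoetherianRing R] [IsLocalRing R]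
    (hdim : ringKrullDim R = 1)
    (hCM : ∃ x ∈ maximalIdeal R, x ∈ nonZeroDivisors R)
    (C : Submodule R (FractionRing R))
    (hcan : IsCanonicalIdeal R C)
    (hRC : (1 : Submodule R (FractionRing R)) ≤ C)
    (hCRbar : C ≤ Subalgebra.toSubmodule (integralClosure R (FractionRing R)))
    (hfin : (Subalgebra.toSubmodule (integralClosure R (FractionRing R))).FG)
    (hloc : IsLocalRing (integralClosure R (FractionRing R)))
    (hred : ∃ a ∈ maximalIdeal R, a ∈ nonZeroDivisors R ∧
      ∃ n : ℕ, maximalIdeal R ^ (n + 1) = Ideal.span {a} * maximalIdeal R ^ n)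
    (hFFG : ((1 : Submodule R (FractionRing R)) / C) * C =
      (1 : Submodule R (FractionRing R)) /
        Subalgebra.toSubmodule (integralClosure R (FractionRing R)))
    (p : Polynomial ℚ) (hpdeg : p.natDegree = 1)
    (hHilb : ∃ N : ℕ, ∀ n ≥ N,
      ∃ s : CompositionSeries (Submodule R (R ⧸ (maximalIdeal R ^ n))),
        s.head = ⊥ ∧ s.last = ⊤ ∧ (s.length : ℚ) = p.eval (n : ℚ))
    (e : ℕ) (he : (e : ℚ) = p.leadingCoeff)
    (hr : Nonempty ((((Ext R (ModuleCat.{u} R) 1).obj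
        (Opposite.op (ModuleCat.of R (ResidueField R)))).obj (ModuleCat.of R R))
      ≃ₗ[R] (Fin 2 → ResidueField R))) :
    e = Module.finrank (ResidueField R) (CotangentSpace R) ∧ e = 3 := by
  obtain ⟨a, ham, ha, n, hn⟩ := hred
  have hlen_e := length_quotient_reduction_eq_leadingCoeff ha hn p hpdeg hHilb e he
  have hlen := length_quotient_eq_two_add_of_ext ham ha hr
  obtain ⟨x, y, hxy⟩ :=
    hcan.exists_eq_span_pair hRC ham ha (by rw [hlen_e]; exact ENat.natCast_ne_top e) hlen
  have hCC := hcan.mul_self_eq hRC _ hCRbar hfin hFFG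
  rw [hxy] at hCC
  obtain ⟨hthree, hsq⟩ := length_eq_three_and_maximalIdeal_sq_le hlen
    (length_quotient_reduction_le_three hdim.le ham ha hn hCC) ham
  have he3 : e = 3 := by exact_mod_cast hlen_e.symm.trans hthree
  refine ⟨?_, he3⟩
  have hlen_sq := length_quotient_maximalIdeal_sq (R := R)
  rw [maximalIdeal_sq_eq_span_singleton_mul ham ha hn hsq, length_quotient_span_singleton_mul ha,
    length_quotient_maximalIdeal, hlen_e, add_comm] at hlen_sq
  have : e + 1 = Module.finrank (ResidueField R) (CotangentSpace R) + 1 := by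
    exact_mod_cast hlen_sq
  lia
end

section
/- Let R be a one-dimensional far-flung Gorenstein local ring satisfying conditions (a)-(c), and let M be a finitely generated reflexive R-module of rank r > 0. Then Hom_R(ω_R, M) is isomorphic to R̄^r as an R-module. -/
set_option synthInstance.maxHeartbeats 400000

open IsLocalRing

universe u v

open scoped nonZeroDivisors

section TotalQuotientRing

/-- If the integral closure of a Noetherian local ring `R` in an `R`-algebra `K` is finite, and
some element of the maximal ideal becomes invertible in `K`, then `K` is reduced. -/
theorem isReduced_of_integralClosure_fg {R K : Type*} [CommRing R] [IsNoetherianRing R]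
    [IsLocalRing R] [CommRing K] [Algebra R K] {x : R} (hx : x ∈ maximalIdeal R)
    (hxK : IsUnit (algebraMap R K x))
    (hfin : (Subalgebra.toSubmodule (integralClosure R K)).FG) : IsReduced K := by
  let N : Submodule R K := (nilradical K).restrictScalars R
  have hN : N ≤ Subalgebra.toSubmodule (integralClosure R K) := by
    intro y hy
    obtain ⟨n, hn⟩ : IsNilpotent y := hy
    have h : IsIntegral R (y ^ (n + 1)) := by
      rw [pow_succ, hn, zero_mul]
      exact isIntegral_zero
    exact IsIntegral.of_pow n.succ_pos h
  have := isNoetherian_of_fg_of_noetherian _ hfin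
  have hNfg : N.FG := by
    have h := IsNoetherian.noetherian (N.submoduleOf (Subalgebra.toSubmodule (integralClosure R K)))
    have h2 := h.map (Subalgebra.toSubmodule (integralClosure R K)).subtype
    rwa [Submodule.submoduleOf, Submodule.map_comap_subtype, inf_eq_right.mpr hN] at h2
  have hbot : N = ⊥ := by
    refine Submodule.eq_bot_of_le_smul_of_le_jacobson_bot (maximalIdeal R) N hNfg ?_
      (maximalIdeal_le_jacobson _)
    intro y hy
    obtain ⟨u, hu⟩ := hxK
    have h1 : x • ((↑u⁻¹ : K) * y) = y := by
      rw [Algebra.smul_def, ← hu, ← mul_assoc, Units.mul_inv, one_mul]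
    rw [← h1]
    exact Submodule.smul_mem_smul hx (Ideal.mul_mem_left (nilradical K) _ hy)
  refine ⟨fun y hy => ?_⟩
  have : y ∈ N := hy
  rwa [hbot, Submodule.mem_bot] at this

/-- A reduced Noetherian ring which is its own total quotient ring and has no nontrivial
idempotents is a field. -/
theorem isField_of_isReduced_of_idempotents {K : Type*} [CommRing K] [Nontrivial K]
    [IsNoetherianRing K] [IsReduced K] (hunit : ∀ a ∈ K⁰, IsUnit a)
    (hidem : ∀ e : K, e * e = e → e = 0 ∨ e = 1) : IsField K := by
  refine ⟨exists_pair_ne K, mul_comm, fun {a} ha => ?_⟩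
  let I : Ideal K := Ideal.span {a} ⊔ (Ideal.span {a}).annihilator
  have hann : ¬ Disjoint (I : Set K) (K⁰ : Set K) := by
    intro hd
    obtain ⟨c, hc, hc0⟩ :=
      SetLike.exists_of_lt (Ideal.bot_lt_annihilator_of_disjoint_nonZeroDivisors hd)
    rw [Module.mem_annihilator] at hc
    have hca : c * a = 0 := congrArg Subtype.val
      (hc ⟨a, Ideal.mem_sup_left (Ideal.mem_span_singleton_self a)⟩)
    have hcI : c ∈ I := Ideal.mem_sup_right (Submodule.mem_annihilator_span_singleton a c |>.2 hca)
    have hcc : c * c = 0 := congrArg Subtype.val (hc ⟨c, hcI⟩)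
    exact hc0 ((Submodule.mem_bot K).2 (eq_zero_of_pow_eq_zero ((pow_two c).trans hcc)))
  obtain ⟨s, hsI, hs⟩ := Set.not_disjoint_iff.1 hann
  have htop : (1 : K) ∈ I := by
    rw [← Ideal.eq_top_iff_one]
    exact Ideal.eq_top_of_isUnit_mem _ hsI (hunit s hs)
  obtain ⟨u, hu, b, hb, hub⟩ := Submodule.mem_sup.1 htop
  obtain ⟨y, rfl⟩ := Ideal.mem_span_singleton.1 hu
  have hab : b * a = 0 := (Submodule.mem_annihilator_span_singleton a b).1 hb
  rcases hidem (a * y) (by linear_combination (a * y) * hub - y * hab) with h | h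
  · exact absurd (by linear_combination a * h + hab - a * hub : a = 0) ha
  · exact ⟨y, h⟩

/-- A Noetherian local ring of positive depth whose integral closure in its total quotient ring
is finite and local is a domain. -/
theorem isDomain_of_integralClosure_fg_of_isLocalRing {R K : Type*} [CommRing R]
    [IsNoetherianRing R] [IsLocalRing R] [CommRing K] [Algebra R K] [IsFractionRing R K]
    (hdepth : ∃ x ∈ maximalIdeal R, x ∈ R⁰)
    (hfin : (Subalgebra.toSubmodule (integralClosure R K)).FG)
    (hloc : IsLocalRing (integralClosure R K)) : IsDomain R := by
  obtain ⟨x, hx, hx0⟩ := hdepth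
  have hinj : Function.Injective (algebraMap R K) := IsFractionRing.injective R K
  have : Nontrivial K := hinj.nontrivial
  have : IsReduced K :=
    isReduced_of_integralClosure_fg hx (IsLocalization.map_units K ⟨x, hx0⟩) hfin
  have : IsNoetherianRing K := IsLocalization.isNoetherianRing R⁰ K inferInstance
  have hK : IsField K := by
    refine isField_of_isReduced_of_idempotents (fun a ha => ?_) fun e he => ?_
    · obtain ⟨⟨r, s⟩, hrs⟩ := IsLocalization.surj R⁰ a
      have hr : r ∈ R⁰ := by
        rw [mem_nonZeroDivisors_iff_right]
        intro z hz
        have h1 : algebraMap R K z * algebraMap R K s * a = 0 := by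
          rw [mul_assoc, mul_comm _ a, hrs, ← map_mul, hz, map_zero]
        have h2 := (mem_nonZeroDivisors_iff_right.1 ha) _ h1
        rw [← map_mul] at h2
        exact (mem_nonZeroDivisors_iff_right.1 s.2) _ (hinj (by rw [h2, map_zero]))
      have := IsLocalization.map_units K (⟨r, hr⟩ : R⁰)
      exact isUnit_of_mul_isUnit_left (hrs ▸ this)
    · have heI : IsIntegral R e := by
        refine ⟨Polynomial.X ^ 2 - Polynomial.X, by monicity!, ?_⟩
        simp [pow_two, he]
      let e' : integralClosure R K := ⟨e, heI⟩
      have he' : IsIdempotentElem e' := Subtype.ext he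
      rcases IsLocalRing.isUnit_or_isUnit_one_sub_self e' with h | h
      · right
        exact congrArg Subtype.val ((h.mul_eq_left (b := e')).1 he')
      · left
        have h0 : (1 - e') * e' = 0 := by rw [sub_mul, one_mul, he'.eq, sub_self]
        exact congrArg Subtype.val (h.mul_right_eq_zero.1 h0)
  have := hK.isDomain
  exact hinj.isDomain

end TotalQuotientRing

section FractionalIdeals

variable {R K : Type*} [CommRing R] [IsDomain R] [Field K] [Algebra R K] [IsFractionRing R K]

/-- A finite local integral closure of a one-dimensional Noetherian domain in its fraction field is
a principal ideal domain. -/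
theorem isPrincipalIdealRing_integralClosure [IsNoetherianRing R] [Ring.DimensionLEOne R]
    [Module.Finite R (integralClosure R K)] [IsLocalRing (integralClosure R K)] :
    IsPrincipalIdealRing (integralClosure R K) := by
  have : IsNoetherianRing (integralClosure R K) := IsNoetherianRing.of_finite R _
  have : IsFractionRing (integralClosure R K) K :=
    integralClosure.isFractionRing_of_finite_extension K K
  have : IsIntegrallyClosed (integralClosure R K) :=
    integralClosure.isIntegrallyClosedOfFiniteExtension K
  have : IsDedekindDomain (integralClosure R K) := { }
  infer_instance

/-- A linear map from a fractional ideal containing `1` to a torsion-free module is determined by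
its value at `1`. -/
theorem evalOne_injective {C : Submodule R K} (h1 : (1 : K) ∈ C) {M : Type*} [AddCommGroup M]
    [Module R M] [Module.IsTorsionFree R M] :
    Function.Injective (LinearMap.applyₗ (R := R) (M₂ := M) (⟨1, h1⟩ : C)) := by
  rw [← LinearMap.ker_eq_bot, LinearMap.ker_eq_bot']
  intro f hf
  replace hf : f ⟨1, h1⟩ = 0 := hf
  ext c
  obtain ⟨⟨a, b⟩, hab⟩ := IsLocalization.surj R⁰ (c : K)
  have hbc : (b : R) • c = a • (⟨1, h1⟩ : C) := Subtype.ext <| by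
    simpa [Algebra.smul_def, mul_comm] using hab
  have h := congrArg f hbc
  rw [map_smul, map_smul, hf, smul_zero] at h
  simpa using (smul_eq_zero.1 h).resolve_left (nonZeroDivisors.ne_zero b.2)

/-- The dual of a fractional ideal `C` containing `1` is `R : C`. -/
theorem nonempty_dual_linearEquiv_one_div {C : Submodule R K} (h1 : (1 : K) ∈ C) :
    Nonempty (Module.Dual R C ≃ₗ[R] ((1 : Submodule R K) / C : Submodule R K)) := by
  let e : R ≃ₗ[R] (1 : Submodule R K) :=
    (LinearEquiv.ofInjective (Algebra.linearMap R K) (IsFractionRing.injective R K)).trans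
      (LinearEquiv.ofEq _ _ Submodule.one_eq_range.symm)
  have he (r : R) : ((e r : (1 : Submodule R K)) : K) = algebraMap R K r := rfl
  let φ : Module.Dual R C →ₗ[R] K :=
    (Algebra.linearMap R K).comp (LinearMap.applyₗ (⟨1, h1⟩ : C))
  have hφ (f : Module.Dual R C) : φ f = algebraMap R K (f ⟨1, h1⟩) := rfl
  have hφi : Function.Injective φ :=
    (IsFractionRing.injective R K).comp (evalOne_injective h1)
  have hmul (f : Module.Dual R C) (c : C) : φ f * c = algebraMap R K (f c) := by
    obtain ⟨⟨a, b⟩, hab⟩ := IsLocalization.surj R⁰ (c : K)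
    have hbc : (b : R) • c = a • (⟨1, h1⟩ : C) := Subtype.ext <| by
      simpa [Algebra.smul_def, mul_comm] using hab
    have h := congrArg (algebraMap R K) (congrArg f hbc)
    simp only [map_smul, smul_eq_mul, map_mul] at h
    have hb : algebraMap R K b ≠ 0 := (IsLocalization.map_units K b).ne_zero
    apply mul_left_cancel₀ hb
    rw [h, hφ, ← hab]
    ring
  have hrange : LinearMap.range φ = 1 / C := by
    ext z
    rw [Submodule.mem_div_iff_forall_mul_mem]
    constructor
    · rintro ⟨f, rfl⟩ c hc
      rw [hmul f ⟨c, hc⟩]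
      exact Submodule.algebraMap_mem _
    · intro hz
      let g : C →ₗ[R] (1 : Submodule R K) :=
        ((LinearMap.mulLeft R z).comp C.subtype).codRestrict 1 fun c => hz c c.2
      refine ⟨e.symm.toLinearMap.comp g, ?_⟩
      rw [hφ, ← he, LinearMap.comp_apply, LinearEquiv.coe_coe, LinearEquiv.apply_symm_apply]
      exact mul_one z
  exact ⟨(LinearEquiv.ofInjective φ hφi).trans (LinearEquiv.ofEq _ _ hrange)⟩

end FractionalIdeals

/-- If `R ⊆ C ⊆ S` and `(R : C) C = R : S` then `R : C` is the conductor `R : S`. -/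
theorem one_div_eq_of_one_div_mul_eq {R K : Type*} [CommRing R] [CommRing K]
    [Algebra R K] {C S : Submodule R K} (h1 : 1 ≤ C) (hCS : C ≤ S)
    (h : 1 / C * C = 1 / S) : 1 / C = 1 / S := by
  refine le_antisymm ?_ fun z hz => ?_
  · rw [← h]
    exact le_mul_of_one_le_right' h1
  · rw [Submodule.mem_div_iff_forall_mul_mem] at hz ⊢
    exact fun c hc => hz c (hCS hc)

/-- If a subalgebra `S` of the fraction field is a finite `R`-module and a principal ideal ring,
then it is isomorphic to its conductor `R : S`. -/
theorem nonempty_linearEquiv_one_div_toSubmodule {R K : Type*} [CommRing R] [Field K]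
    [Algebra R K] [IsFractionRing R K] (S : Subalgebra R K) [IsPrincipalIdealRing S]
    (hfin : (Subalgebra.toSubmodule S).FG) :
    Nonempty (S ≃ₗ[R] ((1 : Submodule R K) / Subalgebra.toSubmodule S : Submodule R K)) := by
  set J : Submodule R K := 1 / Subalgebra.toSubmodule S
  have hJ {z : K} : z ∈ J ↔ ∀ s ∈ S, z * s ∈ (1 : Submodule R K) :=
    Submodule.mem_div_iff_forall_mul_mem
  have hJS {z : K} (hz : z ∈ J) : z ∈ S := by
    obtain ⟨r, hr⟩ := Submodule.mem_one.1 (hJ.1 hz 1 S.one_mem)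
    rw [mul_one] at hr
    exact hr ▸ S.algebraMap_mem r
  let I : Ideal S :=
    { carrier := {s | (s : K) ∈ J}
      add_mem' := fun {a b} ha hb => J.add_mem ha hb
      zero_mem' := J.zero_mem
      smul_mem' := fun c x hx => hJ.2 fun s hs => by
        have := hJ.1 hx (c * s) (S.mul_mem c.2 hs)
        convert this using 1
        simp only [smul_eq_mul, MulMemClass.coe_mul]
        ring }
  obtain ⟨g, hg⟩ := (IsPrincipalIdealRing.principal I).principal
  have hmem {s : S} : (s : K) ∈ J ↔ ∃ a, a * g = s := by
    rw [← Ideal.mem_span_singleton', Ideal.span, ← hg]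
    rfl
  obtain ⟨d, hd0, hd⟩ := FractionalIdeal.isFractional_of_fg (S := R⁰) hfin
  have hdJ : algebraMap R K d ∈ J := hJ.2 fun s hs => by
    obtain ⟨r, hr⟩ := hd s hs
    rw [← Algebra.smul_def, ← hr]
    exact Submodule.algebraMap_mem r
  have hg0 : (g : K) ≠ 0 := by
    intro h0
    obtain ⟨a, ha⟩ := (hmem (s := ⟨_, hJS hdJ⟩)).1 hdJ
    have := congrArg Subtype.val ha
    rw [MulMemClass.coe_mul, h0, mul_zero] at this
    exact (IsLocalization.map_units K (⟨d, hd0⟩ : R⁰)).ne_zero this.symm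
  let φ : S →ₗ[R] J := ((LinearMap.mulRight R (g : K)).comp S.val.toLinearMap).codRestrict J
    fun s => (hmem (s := s * g)).2 ⟨s, rfl⟩
  refine ⟨LinearEquiv.ofBijective φ ⟨fun a b hab => ?_, fun z => ?_⟩⟩
  · exact Subtype.ext (mul_right_cancel₀ hg0 (congrArg Subtype.val hab))
  · obtain ⟨a, ha⟩ := (hmem (s := ⟨z, hJS z.2⟩)).1 z.2
    exact ⟨a, Subtype.ext (congrArg (Subtype.val : S → K) ha)⟩

/-- Linear maps from a finite module to a module-finite principal ideal domain form a finite free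
module over the latter. -/
theorem exists_linearMap_linearEquiv_pi (R N S : Type*) [CommRing R] [IsNoetherianRing R]
    [AddCommGroup N] [Module R N] [Module.Finite R N] [CommRing S] [IsDomain S]
    [IsPrincipalIdealRing S] [Algebra R S] [Module.Finite R S] :
    ∃ k : ℕ, Nonempty ((N →ₗ[R] S) ≃ₗ[R] (Fin k → S)) := by
  have : Module.Finite S (N →ₗ[R] S) := Module.Finite.of_restrictScalars_finite R S _
  exact ⟨_, ⟨(Module.finBasis S (N →ₗ[R] S)).equivFun.restrictScalars R⟩⟩

/-- A module over a domain whose localization at some prime ideal is free of rank `r` has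
rank `r`. -/
theorem finrank_eq_of_localizedModule {R M : Type*} [CommRing R] [IsDomain R] [AddCommGroup M]
    [Module R M] {r : ℕ} (p : Ideal R) [p.IsPrime]
    (h : Nonempty (LocalizedModule p.primeCompl M ≃ₗ[Localization p.primeCompl]
      (Fin r → Localization p.primeCompl))) : Module.finrank R M = r := by
  have hle : p.primeCompl ≤ R⁰ := p.primeCompl_le_nonZeroDivisors
  rw [← IsLocalizedModule.finrank_eq p.primeCompl
      (LocalizedModule.mkLinearMap p.primeCompl M) hle,
    ← IsLocalization.finrank_eq (Localization p.primeCompl) p.primeCompl hle,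
    h.some.finrank_eq, Module.finrank_fin_fun]

/-- If `S` is a principal ideal domain which is a finite `R`-module and `C` has dual isomorphic to
`S`, then linear maps from `C` to a finite reflexive `R`-module form a finite free `S`-module. -/
theorem exists_linearMap_reflexive_linearEquiv_pi {R C S : Type*} [CommRing R] [IsNoetherianRing R]
    [AddCommGroup C] [Module R C] [CommRing S] [IsDomain S] [IsPrincipalIdealRing S] [Algebra R S]
    [Module.Finite R S] (e : Module.Dual R C ≃ₗ[R] S) (M : Type*) [AddCommGroup M] [Module R M]
    [Module.Finite R M] [Module.IsReflexive R M] :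
    ∃ k : ℕ, Nonempty ((C →ₗ[R] M) ≃ₗ[R] (Fin k → S)) := by
  have : Module.Finite R (Module.Dual R M) :=
    inferInstanceAs (Module.Finite R (M →ₗ[R] R))
  obtain ⟨k, ⟨f⟩⟩ := exists_linearMap_linearEquiv_pi R (Module.Dual R M) S
  let e₁ : (C →ₗ[R] M) ≃ₗ[R] (C →ₗ[R] Module.Dual R M →ₗ[R] R) :=
    LinearEquiv.congrRight (Module.evalEquiv R M)
  let e₂ : (C →ₗ[R] Module.Dual R M →ₗ[R] R) ≃ₗ[R] (Module.Dual R M →ₗ[R] C →ₗ[R] R) :=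
    LinearMap.lflip
  let e₃ : (Module.Dual R M →ₗ[R] C →ₗ[R] R) ≃ₗ[R] (Module.Dual R M →ₗ[R] S) :=
    LinearEquiv.congrRight e
  exact ⟨k, ⟨e₁ ≪≫ₗ e₂ ≪≫ₗ e₃ ≪≫ₗ f⟩⟩

/-- Over the fraction field of a domain `R`, let `C` be a submodule containing `1` whose dual is
isomorphic to a nontrivial finite torsion-free module `S` embedding into `R`. If
`Hom(C, M) ≅ S ^ k` for a finite torsion-free module `M`, then `k` is the rank of `M`. -/
theorem eq_finrank_of_linearMap_linearEquiv_pi {R K : Type*} [CommRing R] [IsDomain R]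
    [IsNoetherianRing R] [Field K] [Algebra R K] [IsFractionRing R K] {C : Submodule R K}
    (h1 : (1 : K) ∈ C) {S M : Type*} [AddCommGroup S] [Module R S] [Nontrivial S]
    [Module.IsTorsionFree R S] (e : Module.Dual R C ≃ₗ[R] S)
    [AddCommGroup M] [Module R M] [Module.Finite R M] [Module.IsTorsionFree R M] {k : ℕ}
    (f : (C →ₗ[R] M) ≃ₗ[R] (Fin k → S)) : k = Module.finrank R M := by
  obtain ⟨s, hs⟩ := exists_ne (0 : S)
  let i : S →ₗ[R] R := (LinearMap.applyₗ (⟨1, h1⟩ : C)).comp e.symm.toLinearMap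
  have hi : Function.Injective i := (evalOne_injective h1).comp e.symm.injective
  let j : M →ₗ[R] (C →ₗ[R] M) := LinearMap.smulRightₗ (e.symm s)
  have hj : Function.Injective j := by
    rw [← LinearMap.ker_eq_bot, LinearMap.ker_eq_bot']
    intro m hm
    have h : i s • m = 0 := LinearMap.congr_fun hm (⟨1, h1⟩ : C)
    exact (smul_eq_zero.1 h).resolve_left ((map_ne_zero_iff i hi).2 hs)
  apply le_antisymm
  · let g : (Fin k → R) →ₗ[R] M := LinearMap.applyₗ (⟨1, h1⟩ : C) ∘ₗ f.symm.toLinearMap ∘ₗ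
      (LinearMap.toSpanSingleton R S s).compLeft (Fin k)
    have hg : Function.Injective g :=
      (evalOne_injective h1).comp (f.symm.injective.comp
        (Function.Injective.comp_left (smul_left_injective R hs)))
    simpa using LinearMap.finrank_le_finrank_of_injective hg
  · let g : M →ₗ[R] (Fin k → R) := i.compLeft (Fin k) ∘ₗ f.toLinearMap ∘ₗ j
    have hg : Function.Injective g :=
      (Function.Injective.comp_left hi).comp (f.injective.comp hj)
    simpa using LinearMap.finrank_le_finrank_of_injective hg

/-- Let `R` be a one-dimensional far-flung Gorenstein local ring
satisfying conditions (a)-(c), and let `M` be a finitely generated reflexive `R`-module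
of rank `r > 0` (i.e. `M_𝔭 ≅ R_𝔭^r` for every associated prime `𝔭` of `R`). Then
`Hom_R(ω_R, M) ≅ R̄^r` as `R`-modules. -/
theorem hom_canonical_reflexive_free_over_integralClosure
    (R : Type u) [CommRing R] [IsNoetherianRing R] [IsLocalRing R]
    (hdim : ringKrullDim R = 1)
    (hCM : ∃ x ∈ maximalIdeal R, x ∈ nonZeroDivisors R)
    (C : Submodule R (FractionRing R))
    (hcan : IsCanonicalIdeal R C)
    (hRC : (1 : Submodule R (FractionRing R)) ≤ C)
    (hCRbar : C ≤ Subalgebra.toSubmodule (integralClosure R (FractionRing R)))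
    (hfin : (Subalgebra.toSubmodule (integralClosure R (FractionRing R))).FG)
    (hloc : IsLocalRing (integralClosure R (FractionRing R)))
    (hFFG : ((1 : Submodule R (FractionRing R)) / C) * C =
      (1 : Submodule R (FractionRing R)) /
        Subalgebra.toSubmodule (integralClosure R (FractionRing R)))
    (M : Type v) [AddCommGroup M] [Module R M] [Module.Finite R M]
    [Module.IsReflexive R M]
    (r : ℕ) (hr : 0 < r)
    (hrank : ∀ (p : Ideal R) (hp : p ∈ associatedPrimes R R),
      haveI : p.IsPrime := hp.1
      Nonempty ((LocalizedModule p.primeCompl M) ≃ₗ[Localization p.primeCompl]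
        (Fin r → Localization p.primeCompl))) :
    Nonempty ((C →ₗ[R] M) ≃ₗ[R]
      (Fin r → Subalgebra.toSubmodule (integralClosure R (FractionRing R)))) := by
  have hdom : IsDomain R := isDomain_of_integralClosure_fg_of_isLocalRing hCM hfin hloc
  have hdimLEOne : Ring.DimensionLEOne R := ⟨fun {p} hp hpp => by
    have : Ring.KrullDimLE 1 R := Ring.krullDimLE_iff.2 hdim.le
    exact hpp.isMaximal_of_ne_bot hp⟩
  have hfinite : Module.Finite R (integralClosure R (FractionRing R)) :=
    Module.Finite.iff_fg.2 hfin
  have hpid : IsPrincipalIdealRing (integralClosure R (FractionRing R)) :=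
    isPrincipalIdealRing_integralClosure
  have h1 : (1 : FractionRing R) ∈ C := Submodule.one_le.1 hRC
  obtain ⟨e₁⟩ := nonempty_dual_linearEquiv_one_div h1
  obtain ⟨e₂⟩ := nonempty_linearEquiv_one_div_toSubmodule _ hfin
  rw [← one_div_eq_of_one_div_mul_eq hRC hCRbar hFFG] at e₂
  obtain ⟨k, ⟨f⟩⟩ := exists_linearMap_reflexive_linearEquiv_pi (e₁.trans e₂.symm) M
  have hk := eq_finrank_of_linearMap_linearEquiv_pi h1 (e₁.trans e₂.symm) f
  obtain ⟨p, hp⟩ := associatedPrimes.nonempty R R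
  have hpp : p.IsPrime := hp.1
  rw [finrank_eq_of_localizedModule p (hrank p hp)] at hk
  subst hk
  exact ⟨f.trans (LinearEquiv.piCongrRight fun _ =>
    (integralClosure R (FractionRing R)).toSubmoduleEquiv.symm)⟩
end
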